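/- The generalized Bernoulli number B_{1,ω^{k-1}} := (1/p) Σ_{a=1}^{p-1} a·ω^{k-1}(a) satisfies the Kummer-type congruence B_{1,ω^{k-1}} ≡ B_k / k (mod p) for even integers k with 2 ≤ k ≤ p−3, where B_k is the k-th Bernoulli number. -/

import Mathlib

theorem aux_poly {R : Type*} [CommRing R] (x y : R) (n : ℕ) :
    (x - y) ^ 2 ∣ x ^ (n + 1) - ((n : R) + 1) * (x * y ^ n) + n * y ^ (n + 1) := by
  induction n with
  | zero => simp
  | succ n ih =>
    obtain ⟨c, hc⟩ := ih
    refine ⟨x * c + (n + 1) * y ^ n, ?_⟩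
    push_cast
    linear_combination x * hc

theorem aux_norm_nat (p : ℕ) [Fact p.Prime] (n : ℕ) (h0 : 0 < n) (hn : n < p) :
    ‖(n : ℚ_[p])‖ = 1 := by
  rw [Padic.norm_natCast_eq_one_iff]
  exact Nat.Coprime.symm (((Nat.Prime.coprime_iff_not_dvd Fact.out).2 (Nat.not_dvd_of_pos_of_lt h0 hn)).symm)

theorem aux_inv (p : ℕ) [Fact p.Prime] (n : ℕ) (h0 : 0 < n) (hn : n < p) :
    ((n : ℚ_[p]))⁻¹ ∈ PadicInt.subring p := by
  rw [PadicInt.mem_subring_iff, norm_inv, aux_norm_nat p n h0 hn, inv_one]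

theorem aux_bern' (p : ℕ) [Fact p.Prime] (n : ℕ) (hn : n + 1 < p) :
    ((bernoulli' n : ℚ) : ℚ_[p]) ∈ PadicInt.subring p := by
  induction n using Nat.strong_induction_on with
  | _ n ih =>
    rw [bernoulli'_def]
    push_cast
    refine sub_mem (one_mem _) (sum_mem fun i hi => ?_)
    have hi := Finset.mem_range.1 hi
    refine mul_mem ?_ (ih i hi (by omega))
    have e : ((n : ℚ_[p]) - i + 1) = ((n - i + 1 : ℕ) : ℚ_[p]) := by
      push_cast [Nat.cast_sub hi.le]; ring
    rw [e, div_eq_mul_inv]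
    exact mul_mem (natCast_mem _ _) (aux_inv p _ (by omega) (by omega))

theorem aux_bern (p : ℕ) [Fact p.Prime] (n : ℕ) (hn : n + 1 < p) :
    ((bernoulli n : ℚ) : ℚ_[p]) ∈ PadicInt.subring p := by
  rw [bernoulli]
  push_cast
  exact mul_mem (pow_mem (neg_mem (one_mem _)) _) (aux_bern' p n hn)

theorem aux_sum (p : ℕ) [Fact p.Prime] (k : ℕ) (hk : k + 1 < p) :
    ∃ r ∈ PadicInt.subring p, ∑ a ∈ Finset.range p, (a : ℚ_[p]) ^ k =
      p * ((bernoulli k : ℚ) : ℚ_[p]) + p ^ 2 * r := by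
  have h := congrArg (fun q : ℚ => (q : ℚ_[p])) (sum_range_pow p k)
  push_cast at h
  rw [Finset.sum_range_succ] at h
  have hk0 : ((k : ℚ_[p]) + 1) ≠ 0 := by exact_mod_cast Nat.succ_ne_zero k
  refine ⟨∑ i ∈ Finset.range k, ((bernoulli i : ℚ) : ℚ_[p]) * ((k + 1).choose i : ℕ) *
    (p : ℚ_[p]) ^ (k - 1 - i) * (((k + 1 : ℕ) : ℚ_[p]))⁻¹, ?_, ?_⟩
  · refine sum_mem fun i hi => ?_
    have hi := Finset.mem_range.1 hi
    exact mul_mem (mul_mem (mul_mem (aux_bern p i (by omega)) (natCast_mem _ _))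
      (pow_mem (natCast_mem _ _) _)) (aux_inv p _ (by omega) hk)
  · rw [h, Finset.mul_sum, add_comm]
    congr 1
    · rw [Nat.choose_succ_self_right]
      have : k + 1 - k = 1 := by omega
      rw [this]
      push_cast
      field_simp
    · refine Finset.sum_congr rfl fun i hi => ?_
      have hi := Finset.mem_range.1 hi
      have : k + 1 - i = (k - 1 - i) + 2 := by omega
      rw [this, pow_add]
      push_cast
      field_simp

theorem aux_units (p : ℕ) [Fact p.Prime] (k : ℕ) (hk : 0 < k) :
    ∑ u : (ZMod p)ˣ, (ZMod.val (u : ZMod p) : ℤ_[p]) ^ k =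
      ∑ a ∈ Finset.range p, (a : ℤ_[p]) ^ k := by
  have hp : p.Prime := Fact.out
  have h1 : ∑ a ∈ Finset.range p, (a : ℤ_[p]) ^ k =
      ∑ a ∈ (Finset.range p).filter (fun a => a ≠ 0), (a : ℤ_[p]) ^ k := by
    symm
    apply Finset.sum_filter_of_ne
    rintro a _ h rfl
    simp [hk.ne'] at h
  rw [h1]
  refine Finset.sum_bij (fun u _ => ZMod.val (u : ZMod p)) ?_ ?_ ?_ ?_
  · intro u _
    simp [ZMod.val_lt]
  · intro u _ v _ h
    exact Units.ext (ZMod.val_injective p h)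
  · intro a ha
    simp only [Finset.mem_filter, Finset.mem_range] at ha
    refine ⟨ZMod.unitOfCoprime a 
      (((Nat.Prime.coprime_iff_not_dvd hp).2
        (Nat.not_dvd_of_pos_of_lt (Nat.pos_of_ne_zero ha.2) ha.1)).symm), Finset.mem_univ _, ?_⟩
    simp [ZMod.val_cast_of_lt ha.1]
  · intro u _
    rfl

theorem aux_main (p : ℕ) [Fact p.Prime] (n : ℕ) (hn : n + 3 ≤ p)
    (ω : (ZMod p)ˣ →* ℤ_[p]ˣ)
    (hω : ∀ σ : (ZMod p)ˣ, PadicInt.toZMod ((ω σ : ℤ_[p])) = (σ : ZMod p)) :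
    (p : ℤ_[p]) ^ 2 ∣ ∑ a ∈ Finset.range p, (a : ℤ_[p]) ^ (n + 1) -
      ((n : ℤ_[p]) + 1) * ∑ u : (ZMod p)ˣ, (ZMod.val (u : ZMod p) : ℤ_[p]) * (ω u : ℤ_[p]) ^ n := by
  have h0 : ∑ u : (ZMod p)ˣ, (ω u : ℤ_[p]) ^ (n + 1) = 0 := by
    have := sum_hom_units_eq_zero ((Units.coeHom ℤ_[p]).comp (ω ^ (n + 1))) ?_
    · simpa using this
    · intro h
      have : ∀ u : (ZMod p)ˣ, u ^ (n + 1) = 1 := by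
        intro u
        have h2 := DFunLike.congr_fun h u
        simp at h2
        have h3 := congrArg PadicInt.toZMod h2
        rw [map_pow, hω, map_one] at h3
        exact Units.ext (by simpa using h3)
      rw [FiniteField.forall_pow_eq_one_iff, ZMod.card] at this
      have := Nat.le_of_dvd (by omega) this
      omega
  rw [← aux_units p (n + 1) (by omega)]
  have : ∑ u : (ZMod p)ˣ, (ZMod.val (u : ZMod p) : ℤ_[p]) ^ (n + 1) -
      ((n : ℤ_[p]) + 1) * ∑ u : (ZMod p)ˣ, (ZMod.val (u : ZMod p) : ℤ_[p]) * (ω u : ℤ_[p]) ^ n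
      = ∑ u : (ZMod p)ˣ, ((ZMod.val (u : ZMod p) : ℤ_[p]) ^ (n + 1) -
      ((n : ℤ_[p]) + 1) * ((ZMod.val (u : ZMod p) : ℤ_[p]) * (ω u : ℤ_[p]) ^ n)
        + n * (ω u : ℤ_[p]) ^ (n + 1)) := by
    rw [Finset.sum_add_distrib, Finset.sum_sub_distrib, ← Finset.mul_sum, ← Finset.mul_sum, h0]
    simp
  rw [this]
  refine Finset.dvd_sum fun u _ => dvd_trans (pow_dvd_pow_of_dvd ?_ 2) (aux_poly _ _ n)
  rw [← Ideal.mem_span_singleton, ← PadicInt.maximalIdeal_eq_span_p, ← PadicInt.ker_toZMod,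
    RingHom.mem_ker, map_sub, hω]
  simp


/-- For an odd prime `p` and an even `k` with
`2 ≤ k ≤ p − 3`, the generalized Bernoulli number
`B_{1,ω^{k-1}} = (1/p) Σ_{a=1}^{p-1} a·ω^{k-1}(a)` (sum over
`a ∈ (ℤ/pℤ)^×`, `ω` the Teichmüller character) satisfies
`B_{1,ω^{k-1}} ≡ B_k / k (mod p)` in `ℤ_p`, i.e. the difference has
`p`-adic norm at most `1/p`. -/
theorem stmt8 (p : ℕ) [Fact p.Prime] (hp : Odd p) (k : ℕ) (hk : Even k)
    (hk2 : 2 ≤ k) (hk3 : k ≤ p - 3)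
    (ω : (ZMod p)ˣ →* ℤ_[p]ˣ)
    (hω : ∀ σ : (ZMod p)ˣ, PadicInt.toZMod ((ω σ : ℤ_[p])) = (σ : ZMod p)) :
    ‖(∑ u : (ZMod p)ˣ, ((ZMod.val ((u : ZMod p)) : ℚ_[p]) *
          (((ω u : ℤ_[p]) : ℚ_[p]) ^ (k - 1)))) / (p : ℚ_[p])
        - ((bernoulli k : ℚ) : ℚ_[p]) / (k : ℚ_[p])‖ ≤ (p : ℝ)⁻¹ := by
  obtain ⟨n, rfl⟩ : ∃ n, k = n + 1 := ⟨k - 1, by omega⟩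
  obtain ⟨c, hc⟩ := aux_main p n (by omega) ω hω
  obtain ⟨r, hr, hs⟩ := aux_sum p (n + 1) (by omega)
  have hc' := congrArg (PadicInt.Coe.ringHom (p := p)) hc
  simp only [map_sub, map_mul, map_sum, map_pow, map_natCast, map_add, map_one] at hc'
  rw [hs] at hc'
  have hk1 := aux_norm_nat p (n + 1) (by omega) (by omega)
  have hp0 : (p : ℚ_[p]) ≠ 0 := by exact_mod_cast (Fact.out : p.Prime).ne_zero
  have hn0 : ((n + 1 : ℕ) : ℚ_[p]) ≠ 0 := by exact_mod_cast Nat.succ_ne_zero n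
  rw [Nat.add_sub_cancel]
  set S := ∑ u : (ZMod p)ˣ, ((ZMod.val ((u : ZMod p)) : ℚ_[p]) *
          (((ω u : ℤ_[p]) : ℚ_[p]) ^ n)) with hS
  have key : S / (p : ℚ_[p]) - ((bernoulli (n + 1) : ℚ) : ℚ_[p]) / ((n + 1 : ℕ) : ℚ_[p]) =
      p * ((r - c) * (((n + 1 : ℕ) : ℚ_[p]))⁻¹) := by
    field_simp
    push_cast
    change _ - _ * S = _ * (c : ℚ_[p]) at hc'
    linear_combination -hc'
  rw [key, norm_mul, norm_mul, norm_inv, hk1, Padic.norm_p]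
  have : ‖r - (c : ℚ_[p])‖ ≤ 1 :=
    (PadicInt.mem_subring_iff p).1 (sub_mem hr c.2)
  have hpp : (0 : ℝ) ≤ (p : ℝ)⁻¹ := by positivity
  nlinarith
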